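/- arXiv:1710.05615 — 5 statements merged into one kernel-verified Lean document; each statement's English description precedes it below -/
import Mathlib

section
/- Let n, m be positive integers, let d_min > 0 be a real number, let a_1, …, a_n be real variable-node degrees with a_u ≥ d_min for every u, and let d_1, …, d_m be positive real check-node degrees, such that ∑_{u=1}^n a_u = ∑_{r=1}^m d_r = E. Then the average repair bandwidth satisfies γ = (∑_{r=1}^m d_r(d_r − 1))/E ≥ d_min·n/m − 1. Equivalently, writing R = 1 − m/n for the code rate, γ ≥ d_min/(1 − R) − 1. -/
/-- **Theorem 1 (lower-bound direction).** For a bipartite factor graph with `n` variable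
nodes of real degrees `a u ≥ dmin > 0` and `m` check nodes of positive real degrees `d r`,
where both degree sums equal the number of edges `E`, the average repair bandwidth
`(∑ r, d r * (d r - 1)) / E` is at least `dmin * n / m - 1 = dmin / (1 - R) - 1`,
with `R = 1 - m/n` the code rate. -/
theorem avg_repair_bandwidth_ge_of_min_vn_degree
    (n m : ℕ) (hn : 0 < n) (hm : 0 < m)
    (dmin : ℝ) (hdmin : 0 < dmin)
    (a : Fin n → ℝ) (ha : ∀ u, dmin ≤ a u)
    (d : Fin m → ℝ) (hd : ∀ r, 0 < d r)
    (E : ℝ) (haE : ∑ u, a u = E) (hdE : ∑ r, d r = E) :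
    (∑ r, d r * (d r - 1)) / E ≥ dmin * n / m - 1 := by
  have hn' : (0:ℝ) < n := by exact_mod_cast hn
  have hm' : (0:ℝ) < m := by exact_mod_cast hm
  have h1 : dmin * n ≤ E := by
    have h := Finset.sum_le_sum (fun u (_ : u ∈ Finset.univ) => ha u)
    rw [haE] at h
    simp at h
    linarith
  have hE : 0 < E := lt_of_lt_of_le (mul_pos hdmin hn') h1
  have h2 : E ^ 2 ≤ m * ∑ r, d r ^ 2 := by
    have h := sq_sum_le_card_mul_sum_sq (s := Finset.univ) (f := d)
    rw [hdE] at h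
    simpa using h
  have h3 : ∑ r, d r * (d r - 1) = ∑ r, d r ^ 2 - E := by
    rw [← hdE, ← Finset.sum_sub_distrib]
    exact Finset.sum_congr rfl (fun r _ => by ring)
  have h4 : E / m ≤ (∑ r, d r ^ 2) / E := by
    rw [div_le_div_iff₀ hm' hE]
    linarith
  have h5 : dmin * n / m ≤ E / m := by gcongr
  rw [h3, sub_div, div_self hE.ne']
  linarith
end

section
/- Let n, m be positive integers, let d_min > 0 be a real number, let a_1, …, a_n be real variable-node degrees with a_u ≥ d_min for every u, and let d_1, …, d_m be positive real check-node degrees, such that ∑_{u=1}^n a_u = ∑_{r=1}^m d_r = E. Then the average repair bandwidth γ = (∑_{r=1}^m d_r(d_r − 1))/E equals d_min·n/m − 1 if and only if the graph is both check-node-regular and variable-node-regular with d_r = d_min·n/m for every r and a_u = d_min for every u. -/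
/-- **Theorem 1 (equality characterization).** For a bipartite factor graph with `n`
variable nodes of real degrees `a u ≥ dmin > 0` and `m` check nodes of positive real
degrees `d r`, where both degree sums equal the number of edges `E`, the average repair
bandwidth `(∑ r, d r * (d r - 1)) / E` equals `dmin * n / m - 1` if and only if the graph
is both check-node-regular with common degree `dmin * n / m` and variable-node-regular
with common degree `dmin`. -/
theorem avg_repair_bandwidth_eq_iff_biregular
    (n m : ℕ) (hn : 0 < n) (hm : 0 < m)
    (dmin : ℝ) (hdmin : 0 < dmin)
    (a : Fin n → ℝ) (ha : ∀ u, dmin ≤ a u)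
    (d : Fin m → ℝ) (hd : ∀ r, 0 < d r)
    (E : ℝ) (haE : ∑ u, a u = E) (hdE : ∑ r, d r = E) :
    (∑ r, d r * (d r - 1)) / E = dmin * n / m - 1 ↔
      (∀ r, d r = dmin * n / m) ∧ (∀ u, a u = dmin) := by
  have hm' : (0 : ℝ) < m := by exact_mod_cast hm
  have hn' : (0 : ℝ) < n := by exact_mod_cast hn
  obtain ⟨c, hc⟩ : ∃ c : ℝ, c = dmin * n / m := ⟨_, rfl⟩
  have hcm : c * m = dmin * n := by rw [hc]; field_simp
  have hc0 : 0 < c := by rw [hc]; positivity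
  have hasum : ∑ u, (a u - dmin) = E - c * m := by
    rw [Finset.sum_sub_distrib, haE, hcm]; simp [mul_comm]
  have hnn : ∀ u ∈ Finset.univ, 0 ≤ a u - dmin := fun u _ => sub_nonneg.2 (ha u)
  have hE : c * m ≤ E := by
    have := Finset.sum_nonneg hnn
    linarith
  have hE0 : 0 < E := lt_of_lt_of_le (mul_pos hc0 hm') hE
  rw [← hc, div_eq_iff hE0.ne']
  constructor
  · intro h
    have h1 : ∑ r, (d r - c) ^ 2 = c * (c * m - E) := by
      have h2 : ∑ r, (d r - c) ^ 2
          = ∑ r, (d r * (d r - 1) + (1 - 2 * c) * d r + c ^ 2) :=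
        Finset.sum_congr rfl fun r _ => by ring
      rw [h2, Finset.sum_add_distrib, Finset.sum_add_distrib, ← Finset.mul_sum, h, hdE]
      simp only [Finset.sum_const, Finset.card_univ, Fintype.card_fin, nsmul_eq_mul]
      ring
    have hsq : ∀ r ∈ Finset.univ, 0 ≤ (d r - c) ^ 2 := fun r _ => sq_nonneg _
    have h3 : c * (c * m - E) = 0 := by
      apply le_antisymm
      · exact mul_nonpos_of_nonneg_of_nonpos hc0.le (by linarith)
      · rw [← h1]; exact Finset.sum_nonneg hsq
    have h4 : E - c * m = 0 := by
      rcases mul_eq_zero.1 h3 with h | h <;> linarith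
    rw [h3] at h1
    rw [h4] at hasum
    constructor
    · intro r
      have := (Finset.sum_eq_zero_iff_of_nonneg hsq).1 h1 r (Finset.mem_univ r)
      exact sub_eq_zero.1 (pow_eq_zero_iff two_ne_zero |>.1 this)
    · intro u
      exact sub_eq_zero.1
        ((Finset.sum_eq_zero_iff_of_nonneg hnn).1 hasum u (Finset.mem_univ u))
  · rintro ⟨h, -⟩
    rw [← hdE, Finset.mul_sum]
    exact Finset.sum_congr rfl fun r _ => by rw [h r]; ring
end

section
/- Let n, m, d_min be positive integers with m < n, let a_1, …, a_n be natural-number variable-node degrees with a_u ≥ d_min for every u, and let d_1, …, d_m be natural-number check-node degrees, with ∑_{u=1}^n a_u = ∑_{r=1}^m d_r = E. If the minimum average repair bandwidth is achieved, i.e. (∑_{r=1}^m d_r(d_r − 1))/E = d_min·n/m − 1, then m divides d_min·n and the common check-node degree d_min·n/m is an integer strictly greater than d_min. Equivalently, with rate R = 1 − m/n, minimum repair bandwidth is possible only if d_min/(1 − R) is an integer greater than d_min. -/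
/-- **Corollary 1.** For a bipartite factor graph with `n` variable nodes of
natural-number degrees `a u ≥ dmin > 0` and `m < n` check nodes of natural-number
degrees `d r`, where both degree sums equal `E`, if the minimum average repair bandwidth
`dmin * n / m - 1` is achieved, then `m` divides `dmin * n` and the common check-node
degree `dc = dmin * n / m` is an integer strictly greater than `dmin`;
equivalently `dmin / (1 - R)` is an integer greater than `dmin` for rate `R = 1 - m/n`. -/
theorem min_repair_bandwidth_integrality
    (n m dmin : ℕ) (hm : 0 < m) (hmn : m < n) (hdmin : 0 < dmin)
    (a : Fin n → ℕ) (ha : ∀ u, dmin ≤ a u)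
    (d : Fin m → ℕ) (E : ℕ)
    (haE : ∑ u, a u = E) (hdE : ∑ r, d r = E)
    (hmin : (∑ r, (d r : ℝ) * ((d r : ℝ) - 1)) / (E : ℝ)
      = (dmin : ℝ) * (n : ℝ) / (m : ℝ) - 1) :
    ∃ dc : ℕ, dmin * n = m * dc ∧ dmin < dc := by
  have hmR : (0 : ℝ) < m := by exact_mod_cast hm
  have hEge : dmin * n ≤ E := by
    rw [← haE]
    have h := Finset.sum_le_sum (s := Finset.univ) (fun u _ => ha u)
    simp only [Finset.sum_const, Finset.card_univ, Fintype.card_fin, smul_eq_mul] at h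
    rw [mul_comm]
    exact h
  have hE0 : 0 < E := lt_of_lt_of_le (Nat.mul_pos hdmin (by omega)) hEge
  have hER : (0 : ℝ) < E := by exact_mod_cast hE0
  have hEgeR : (dmin : ℝ) * n ≤ E := by exact_mod_cast hEge
  have hdER : ∑ r, (d r : ℝ) = E := by exact_mod_cast hdE
  obtain ⟨c, hc⟩ : ∃ c : ℝ, c = (dmin : ℝ) * n / m := ⟨_, rfl⟩
  have hc0 : 0 ≤ c := by rw [hc]; positivity
  have hcm : (m : ℝ) * c = dmin * n := by rw [hc]; field_simp
  rw [← hc, div_eq_iff hER.ne'] at hmin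
  have hsum : ∑ r, ((d r : ℝ) - c) ^ 2 = c * (dmin * n - E) := by
    have h1 : ∀ r, ((d r : ℝ) - c) ^ 2
        = (d r : ℝ) * ((d r : ℝ) - 1) + (1 - 2 * c) * (d r : ℝ) + c ^ 2 := by
      intro r; ring
    simp only [h1, Finset.sum_add_distrib, ← Finset.mul_sum, hmin, hdER, Finset.sum_const,
      Finset.card_univ, Fintype.card_fin, nsmul_eq_mul]
    rw [← hcm]; ring
  have hle : ((d ⟨0, hm⟩ : ℝ) - c) ^ 2 ≤ ∑ r, ((d r : ℝ) - c) ^ 2 :=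
    Finset.single_le_sum (f := fun r => ((d r : ℝ) - c) ^ 2)
      (fun r _ => sq_nonneg _) (Finset.mem_univ (⟨0, hm⟩ : Fin m))
  have hz : ((d ⟨0, hm⟩ : ℝ) - c) ^ 2 ≤ 0 := by
    rw [hsum] at hle
    exact hle.trans (mul_nonpos_of_nonneg_of_nonpos hc0 (by linarith))
  have hdc : (d ⟨0, hm⟩ : ℝ) = c := by
    have := pow_eq_zero_iff (two_ne_zero) |>.1 (le_antisymm hz (sq_nonneg _))
    linarith
  have hkey : dmin * n = m * d ⟨0, hm⟩ := by
    rw [← hdc] at hcm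
    exact_mod_cast hcm.symm
  refine ⟨d ⟨0, hm⟩, hkey, ?_⟩
  by_contra hcon
  have h2 : m * d ⟨0, hm⟩ ≤ m * dmin := Nat.mul_le_mul_left _ (not_lt.1 hcon)
  have h3 : dmin * m < dmin * n := Nat.mul_lt_mul_of_pos_left hmn hdmin
  rw [mul_comm m dmin] at h2
  omega
end

section
/- Let m ≥ 1 be an integer, let n, λ, μ be real numbers, and let p_0, …, p_{m−1} be real numbers. Define g_{m+1} = 1, g_m = (n−m)λ + μ, g_i = ((n−i)λ + μ)·g_{i+1} − μ(n−i)λ·p_i·g_{i+2} for 1 ≤ i ≤ m−1, and g_0 = nλ·g_1 − μnλ·p_0·g_2. Then the identity g_0 = nλ(1−p_0)·g_1 + ∑_{j=1}^{m−1} [ (∏_{i=0}^{j}(n−i))·λ^{j+1} · (∏_{i=0}^{j−1} p_i)·(1−p_j) · g_{j+1} ] + (∏_{i=0}^{m}(n−i))·λ^{m+1} · ∏_{i=0}^{m−1} p_i holds. -/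
open Finset

/-- **Equation (A.13).** For the recursively defined quantities `g i = G_i(0)` of the
Markov-chain analysis — `g (m+1) = 1`, `g m = (n-m)·lam + mu`,
`g i = ((n-i)·lam + mu)·g (i+1) - mu·(n-i)·lam·p i·g (i+2)` for `1 ≤ i ≤ m-1`, and
`g 0 = n·lam·g 1 - mu·n·lam·p 0·g 2` — the identity
`g 0 = n·lam·(1-p 0)·g 1 + ∑_{j=1}^{m-1} (∏_{i≤j}(n-i))·lam^(j+1)·(∏_{i<j} p i)·(1-p j)·g (j+1)
       + (∏_{i≤m}(n-i))·lam^(m+1)·∏_{i<m} p i` holds. -/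
theorem markov_G0_identity
    (m : ℕ) (hm : 1 ≤ m) (n lam mu : ℝ) (p : ℕ → ℝ) (g : ℕ → ℝ)
    (hgm1 : g (m + 1) = 1)
    (hgm : g m = (n - m) * lam + mu)
    (hgi : ∀ i, 1 ≤ i → i ≤ m - 1 →
      g i = ((n - i) * lam + mu) * g (i + 1) - mu * (n - i) * lam * p i * g (i + 2))
    (hg0 : g 0 = n * lam * g 1 - mu * n * lam * p 0 * g 2) :
    g 0 = n * lam * (1 - p 0) * g 1
      + ∑ j ∈ Finset.Icc 1 (m - 1),
          (∏ i ∈ Finset.range (j + 1), (n - i)) * lam ^ (j + 1) *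
            ((∏ i ∈ Finset.range j, p i) * (1 - p j)) * g (j + 1)
      + (∏ i ∈ Finset.range (m + 1), (n - i)) * lam ^ (m + 1) *
          ∏ i ∈ Finset.range m, p i := by
  obtain ⟨M, rfl⟩ : ∃ M, m = M + 1 := ⟨m - 1, by omega⟩
  simp only [Nat.add_sub_cancel] at hgi ⊢
  have key : ∀ k, k ≤ M → g 0 = n * lam * (1 - p 0) * g 1
      + ∑ j ∈ Finset.Icc 1 k,
          (∏ i ∈ Finset.range (j + 1), (n - i)) * lam ^ (j + 1) *
            ((∏ i ∈ Finset.range j, p i) * (1 - p j)) * g (j + 1)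
      + (∏ i ∈ Finset.range (k + 1), (n - i)) * lam ^ (k + 1) *
          (∏ i ∈ Finset.range (k + 1), p i) * (g (k + 1) - mu * g (k + 2)) := by
    intro k
    induction k with
    | zero =>
      intro _
      rw [hg0]
      simp
      ring
    | succ k ih =>
      intro hk
      rw [ih (by omega), Finset.sum_Icc_succ_top (by omega), hgi (k + 1) (by omega) hk,
        Finset.prod_range_succ _ (k + 1), Finset.prod_range_succ _ (k + 1)]
      ring
  rw [key M le_rfl, hgm1, hgm, Finset.prod_range_succ _ (M + 1)]
  ring
end

section
/- Let m ≥ 1 be an integer, let n ≥ m and λ ≥ 0 and μ ≥ 0 be real numbers, and let p_0, …, p_{m−1} ∈ [0,1]. Define g_{m+1} = 1, g_m = (n−m)λ + μ, and g_i = ((n−i)λ + μ)·g_{i+1} − μ(n−i)λ·p_i·g_{i+2} for 1 ≤ i ≤ m−1. Then g_i ≥ μ·g_{i+1} for all 1 ≤ i ≤ m, and consequently g_i ≥ μ^{m−i+1} for all 1 ≤ i ≤ m; in particular g_1 ≥ μ^m, g_2 ≥ μ^{m−1}, …, g_m ≥ μ. -/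
open Finset

/-- **Bounds (A.11).** For the recursively defined quantities `g i = G_i(0)` with
`n ≥ m`, `lam ≥ 0`, `mu ≥ 0` and `p i ∈ [0,1]`, one has `g i ≥ mu * g (i+1)` for all
`1 ≤ i ≤ m`, and consequently `g i ≥ mu^(m-i+1)` for all `1 ≤ i ≤ m`
(in particular `g 1 ≥ mu^m`, …, `g m ≥ mu`). -/
theorem markov_G_lower_bounds
    (m : ℕ) (hm : 1 ≤ m) (n lam mu : ℝ)
    (hnm : (m : ℝ) ≤ n) (hlam : 0 ≤ lam) (hmu : 0 ≤ mu)
    (p : ℕ → ℝ) (hp : ∀ i < m, 0 ≤ p i ∧ p i ≤ 1) (g : ℕ → ℝ)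
    (hgm1 : g (m + 1) = 1)
    (hgm : g m = (n - m) * lam + mu)
    (hgi : ∀ i, 1 ≤ i → i ≤ m - 1 →
      g i = ((n - i) * lam + mu) * g (i + 1) - mu * (n - i) * lam * p i * g (i + 2)) :
    (∀ i, 1 ≤ i → i ≤ m → mu * g (i + 1) ≤ g i) ∧
    (∀ i, 1 ≤ i → i ≤ m → mu ^ (m - i + 1) ≤ g i) := by
  have key : ∀ k i : ℕ, 1 ≤ i → i + k = m →
      mu * g (i + 1) ≤ g i ∧ mu ^ (k + 1) ≤ g i ∧ 0 ≤ g (i + 1) := by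
    intro k
    induction k with
    | zero =>
      intro i h1 h2
      have h2 : i = m := by omega
      subst h2
      have h3 : 0 ≤ (n - i) * lam := mul_nonneg (by linarith) hlam
      rw [hgm1, hgm]
      refine ⟨by linarith, ?_, zero_le_one⟩
      rw [zero_add, pow_one]
      linarith
    | succ k ih =>
      intro i h1 h2
      obtain ⟨ha, hb, hc⟩ := ih (i + 1) (by omega) (by omega)
      have hpos : 0 ≤ g (i + 1) := le_trans (pow_nonneg hmu _) hb
      have him : (i : ℝ) ≤ m := by exact_mod_cast (by omega : i ≤ m)
      have h3 : 0 ≤ (n - i) * lam := mul_nonneg (by linarith) hlam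
      have h4 : p i * (mu * g (i + 1 + 1)) ≤ mu * g (i + 1 + 1) :=
        mul_le_of_le_one_left (mul_nonneg hmu hc) (hp i (by omega)).2
      have h5 := mul_nonneg h3 (by linarith : 0 ≤ g (i + 1) - p i * (mu * g (i + 1 + 1)))
      have h6 : mu * g (i + 1) ≤ g i := by
        rw [hgi i h1 (by omega)]
        change 0 ≤ (n - i) * lam * (g (i + 1) - p i * (mu * g (i + 2))) at h5
        linarith
      refine ⟨h6, ?_, hpos⟩
      rw [pow_succ']
      exact (mul_le_mul_of_nonneg_left hb hmu).trans h6
  exact ⟨fun i h1 h2 => (key (m - i) i h1 (by omega)).1,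
    fun i h1 h2 => (key (m - i) i h1 (by omega)).2.1⟩
end
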